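/- Cost of a half-excursion away from −1 (Lemma 6.2): Assume V satisfies Assumption 1, and set c₁ = 2·min( ∫_{−1}^{−1/2} √(2·V(s)) ds , ∫_{−3/2}^{−1} √(2·V(s)) ds ). There exists C < ∞ such that for every sufficiently large M < ∞ and every sufficiently small δ > 0 there exists ℓ* < ∞ with the following property. For every ℓ ≥ ℓ* and all u₋, u₊ ∈ [−M, M], let A^bc be the set of continuously differentiable u : ℝ → ℝ with u(−2ℓ) = u₋ and u(2ℓ) = u₊; let A be the set of u ∈ A^bc with |u(−ℓ)| ≤ M−δ, |u(0)| ≤ M−δ, |u(ℓ)| ≤ M−δ and u(x) ≤ 1 − 2δ for all x ∈ [−ℓ, ℓ]; and let Ã be the set of u ∈ A^bc with |u(−ℓ)| ≤ M+δ, |u(0)| ≤ M+δ, |u(ℓ)| ≤ M+δ, u(x) ≤ 1 − δ/2 for all x ∈ [−ℓ, ℓ], and |u(0) + 1| ≥ (1−δ)/2. Then inf_{u ∈ Ã} E_{(−2ℓ,2ℓ)}(u) − inf_{u ∈ A} E_{(−2ℓ,2ℓ)}(u) ≥ c₁ − C·δ. -/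

import Mathlib

open MeasureTheory

/-- Assumption 1: `V` is smooth, even, nonnegative, and on `(0,∞)` it vanishes only at `1`,
its derivative vanishes only at `1`, `V''(1) > 0`, and `V` grows at least like `u^{1+β}`. -/
structure Assumption1 (V : ℝ → ℝ) : Prop where
  smooth : ContDiff ℝ (⊤ : ℕ∞) V
  even : ∀ u : ℝ, V (-u) = V u
  nonneg : ∀ u : ℝ, 0 ≤ V u
  zero_iff : ∀ u : ℝ, 0 < u → (V u = 0 ↔ u = 1)
  deriv_zero_iff : ∀ u : ℝ, 0 < u → (deriv V u = 0 ↔ u = 1)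
  second_deriv_pos : 0 < deriv (deriv V) 1
  growth : ∃ C : ℝ, 0 < C ∧ ∃ β : ℝ, 0 < β ∧ ∀ u : ℝ, C ≤ u → u ^ (1 + β) / C ≤ V u

/-- The energy of `u` on `(a,b)`: `E_{(a,b)}(u) = ∫_a^b ((1/2) u'² + V(u))`. -/
noncomputable def energy (V : ℝ → ℝ) (a b : ℝ) (u : ℝ → ℝ) : ℝ :=
  ∫ x in a..b, ((1/2) * (deriv u x)^2 + V (u x))

/-- The constant `c₁ = 2 min(∫_{−1}^{−1/2} √(2V), ∫_{−3/2}^{−1} √(2V))`. -/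
noncomputable def c1 (V : ℝ → ℝ) : ℝ :=
  2 * min (∫ s in (-1:ℝ)..(-1/2), Real.sqrt (2 * V s))
          (∫ s in (-3/2:ℝ)..(-1), Real.sqrt (2 * V s))


lemma aux_flow (g : ℝ → ℝ) (hg : Continuous g) (ε G : ℝ) (hε : 0 < ε)
    (h1 : ∀ x, ε ≤ g x) (h2 : ∀ x, g x ≤ G) :
    ∃ S : ℝ → ℝ, (∀ x, HasDerivAt S (g (S x)) x) ∧ S 0 = -1 ∧ StrictMono S ∧
      ∀ a, ∃ t, S t = a ∧ |t| ≤ |a + 1| / ε := by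
  have hpos : ∀ x, 0 < g x := fun x => lt_of_lt_of_le hε (h1 x)
  have hG : 0 < G := lt_of_lt_of_le (hpos 0) (h2 0)
  have hc : Continuous (fun r => (g r)⁻¹) := hg.inv₀ (fun x => (hpos x).ne')
  let T : ℝ → ℝ := fun s => ∫ r in (-1:ℝ)..s, (g r)⁻¹
  have hT : ∀ s, HasDerivAt T ((g s)⁻¹) s := fun s => hc.integral_hasStrictDerivAt (-1) s |>.hasDerivAt
  have hTm : StrictMono T := strictMono_of_deriv_pos (fun x => by
    rw [(hT x).deriv]; exact inv_pos.2 (hpos x))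
  have hTc : Continuous T := continuous_iff_continuousAt.2 fun x => (hT x).continuousAt
  have hT0 : T (-1) = 0 := by simp [T]
  -- T s - s/G monotone
  have hmono : Monotone (fun s => T s - G⁻¹ * s) := by
    apply monotone_of_deriv_nonneg
    · intro x; exact ((hT x).sub ((hasDerivAt_id x).const_mul G⁻¹)).differentiableAt
    · intro x
      have := ((hT x).sub ((hasDerivAt_id x).const_mul G⁻¹)).deriv
      simp only [id, mul_one] at this
      have e : (fun s => T s - G⁻¹ * s) = (T - fun y => G⁻¹ * y) := rfl
      rw [e, this]
      have := inv_anti₀ (hpos x) (h2 x)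
      linarith
  have hGi : 0 < G⁻¹ := inv_pos.2 hG
  have hsurj : Function.Surjective T := by
    apply hTc.surjective
    · apply Filter.tendsto_atTop_mono' _ (f₁ := fun s => G⁻¹ * s + G⁻¹)
      · filter_upwards [Filter.eventually_ge_atTop (-1:ℝ)] with s hs
        have := hmono hs
        simp only [hT0] at this; linarith
      · exact Filter.tendsto_atTop_add_const_right _ _ (Filter.tendsto_id.const_mul_atTop hGi)
    · apply Filter.tendsto_atBot_mono' _ (f₁ := fun s => G⁻¹ * s + G⁻¹)
      · filter_upwards [Filter.eventually_le_atBot (-1:ℝ)] with s hs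
        have := hmono hs
        simp only [hT0] at this; linarith
      · exact Filter.tendsto_atBot_add_const_right _ _ (Filter.tendsto_id.const_mul_atBot hGi)
  let e := hTm.orderIsoOfSurjective T hsurj
  have he : ∀ s, e s = T s := fun s => rfl
  refine ⟨e.symm, ?_, ?_, e.symm.strictMono, ?_⟩
  · intro x
    have := (hT (e.symm x)).of_local_left_inverse (e.symm.continuous.continuousAt)
      (inv_ne_zero (hpos _).ne') (Filter.Eventually.of_forall fun y => by
        rw [← he]; exact e.apply_symm_apply y)
    simpa using this
  · rw [← hT0, ← he]; exact e.symm_apply_apply _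
  · intro a
    refine ⟨T a, e.symm_apply_apply a, ?_⟩
    have := intervalIntegral.norm_integral_le_of_norm_le_const (a := -1) (b := a)
      (f := fun r => (g r)⁻¹) (C := ε⁻¹) (fun x _ => by
        rw [Real.norm_eq_abs, abs_of_pos (inv_pos.2 (hpos x))]
        exact inv_anti₀ hε (h1 x))
    rw [Real.norm_eq_abs, sub_neg_eq_add] at this
    rw [div_eq_inv_mul]; exact this

lemma aux_psi (τ : ℝ) (hτ : 0 < τ) :
    ∃ ψ p : ℝ → ℝ, (∀ x, HasDerivAt ψ (p x) x) ∧ Continuous p ∧ (∀ x, 0 ≤ p x) ∧ (∀ x, p x ≤ 1) ∧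
      (∀ x, τ ≤ x → p x = 1) ∧ (∀ x, x ≤ 0 → p x = 0) ∧ (∀ x, x ≤ 0 → ψ x = 0) ∧ Monotone ψ ∧
      (∀ y, 0 ≤ y → ∃ t, 0 ≤ t ∧ t ≤ y + τ ∧ ψ t = y) := by
  let p : ℝ → ℝ := fun s => max 0 (min (s / τ) 1)
  have hp : Continuous p := by fun_prop
  have hp0 : ∀ x, 0 ≤ p x := fun x => le_max_left _ _
  have hp1 : ∀ x, p x ≤ 1 := fun x => max_le (by norm_num) (min_le_right _ _)
  have hpt : ∀ x, τ ≤ x → p x = 1 := fun x hx => by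
    have : 1 ≤ x / τ := by rwa [le_div_iff₀ hτ, one_mul]
    simp [p, this]
  have hpn : ∀ x, x ≤ 0 → p x = 0 := fun x hx => by
    have : x / τ ≤ 0 := div_nonpos_of_nonpos_of_nonneg hx hτ.le
    simp [p, this]
  let ψ : ℝ → ℝ := fun t => ∫ s in (0:ℝ)..t, p s
  have hψ : ∀ x, HasDerivAt ψ (p x) x := fun s => hp.integral_hasStrictDerivAt 0 s |>.hasDerivAt
  have hmono : Monotone ψ := monotone_of_deriv_nonneg (fun x => (hψ x).differentiableAt)
    (fun x => by rw [(hψ x).deriv]; exact hp0 x)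
  have hψn : ∀ x, x ≤ 0 → ψ x = 0 := by
    intro x hx
    have : ψ x = ∫ s in (0:ℝ)..x, (0:ℝ) := by
      apply intervalIntegral.integral_congr
      intro s hs
      rw [Set.uIcc_of_ge hx] at hs
      exact hpn s hs.2
    simpa using this
  refine ⟨ψ, p, hψ, hp, hp0, hp1, hpt, hpn, hψn, hmono, ?_⟩
  intro y hy
  have hc : Continuous ψ := continuous_iff_continuousAt.2 fun x => (hψ x).continuousAt
  have hlb : y ≤ ψ (y + τ) := by
    have h1 : ψ (y+τ) = ψ τ + ∫ s in τ..(y+τ), p s := by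
      rw [intervalIntegral.integral_add_adjacent_intervals] <;> exact hp.intervalIntegrable _ _
    have h2 : ∫ s in τ..(y+τ), p s = ∫ s in τ..(y+τ), (1:ℝ) := by
      apply intervalIntegral.integral_congr
      intro s hs
      rw [Set.uIcc_of_le (by linarith)] at hs
      exact hpt s hs.1
    have h3 : 0 ≤ ψ τ := by rw [← hψn 0 le_rfl]; exact hmono hτ.le
    rw [h1, h2]; simp; linarith
  obtain ⟨t, ht, hty⟩ := intermediate_value_Icc (show (0:ℝ) ≤ y + τ by linarith) hc.continuousOn
    (show y ∈ Set.Icc (ψ 0) (ψ (y+τ)) by rw [hψn 0 le_rfl]; exact ⟨hy, hlb⟩)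
  exact ⟨t, ht.1, ht.2, hty⟩

noncomputable def aPhi (V : ℝ → ℝ) (s : ℝ) : ℝ := ∫ r in (-1:ℝ)..s, Real.sqrt (2 * V r)

lemma aPhi_deriv (V : ℝ → ℝ) (hV : Continuous V) (s : ℝ) :
    HasDerivAt (aPhi V) (Real.sqrt (2 * V s)) s := by
  have hc : Continuous (fun r => Real.sqrt (2 * V r)) := by fun_prop
  exact (hc.integral_hasStrictDerivAt (-1) s).hasDerivAt

lemma dens_cont (V : ℝ → ℝ) (hV : Continuous V) (u : ℝ → ℝ) (hu : ContDiff ℝ 1 u) :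
    Continuous (fun x => (1/2) * (deriv u x)^2 + V (u x)) := by
  have := hu.continuous_deriv le_rfl
  have := hu.continuous
  fun_prop

lemma energy_add (V : ℝ → ℝ) (hV : Continuous V) (u : ℝ → ℝ) (hu : ContDiff ℝ 1 u) (a b c : ℝ) :
    energy V a c u = energy V a b u + energy V b c u := by
  have := dens_cont V hV u hu
  unfold energy
  rw [intervalIntegral.integral_add_adjacent_intervals] <;> exact this.intervalIntegrable _ _

lemma energy_nonneg (V : ℝ → ℝ) (h0 : ∀ x, 0 ≤ V x) (u : ℝ → ℝ) (a b : ℝ) (hab : a ≤ b) :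
    0 ≤ energy V a b u := by
  apply intervalIntegral.integral_nonneg hab
  intro x _
  have := h0 (u x)
  positivity

lemma energy_ge_const (V : ℝ → ℝ) (hV : Continuous V)
    (u : ℝ → ℝ) (hu : ContDiff ℝ 1 u) (a b η : ℝ) (hab : a ≤ b)
    (h : ∀ x ∈ Set.Icc a b, η ≤ V (u x)) : η * (b - a) ≤ energy V a b u := by
  have := dens_cont V hV u hu
  have h2 := intervalIntegral.integral_mono_on hab (f := fun _ => η)
    (intervalIntegrable_const (μ := volume)) (this.intervalIntegrable a b) (fun x hx => by
      have := h x hx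
      have := sq_nonneg (deriv u x)
      linarith)
  simp only [intervalIntegral.integral_const, smul_eq_mul] at h2
  unfold energy; linarith

lemma energy_ge (V : ℝ → ℝ) (hV : Continuous V) (h0 : ∀ x, 0 ≤ V x)
    (u : ℝ → ℝ) (hu : ContDiff ℝ 1 u) (a b : ℝ) (hab : a ≤ b) :
    |aPhi V (u b) - aPhi V (u a)| ≤ energy V a b u := by
  have hd := dens_cont V hV u hu
  have hdu := hu.continuous_deriv le_rfl
  have huc := hu.continuous
  have hder : ∀ x, HasDerivAt (fun x => aPhi V (u x)) (Real.sqrt (2 * V (u x)) * deriv u x) x :=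
    fun x => (aPhi_deriv V hV (u x)).comp x ((hu.differentiable (by norm_num)) x).hasDerivAt
  have hcc : Continuous (fun x => Real.sqrt (2 * V (u x)) * deriv u x) := by fun_prop
  have hint : ∫ x in a..b, Real.sqrt (2 * V (u x)) * deriv u x = aPhi V (u b) - aPhi V (u a) :=
    intervalIntegral.integral_eq_sub_of_hasDerivAt (fun x _ => hder x) (hcc.intervalIntegrable _ _)
  have key : ∀ x, |Real.sqrt (2 * V (u x)) * deriv u x| ≤ (1/2) * (deriv u x)^2 + V (u x) := by
    intro x
    have h1 := Real.sq_sqrt (show 0 ≤ 2 * V (u x) by have := h0 (u x); positivity)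
    rw [abs_le]
    constructor <;> nlinarith [sq_nonneg (Real.sqrt (2 * V (u x)) + deriv u x), sq_nonneg (Real.sqrt (2 * V (u x)) - deriv u x)]
  rw [← hint]
  refine (intervalIntegral.abs_integral_le_integral_abs hab).trans ?_
  exact intervalIntegral.integral_mono_on hab (hcc.abs.intervalIntegrable _ _)
    (hd.intervalIntegrable _ _) (fun x _ => key x)

set_option maxHeartbeats 1000000 in
lemma aux_transition (V : ℝ → ℝ) (hV : Continuous V) (h0 : ∀ x, 0 ≤ V x) (hm1 : V (-1) = 0)
    (M δ : ℝ) (hM : 1 ≤ M) (hδ : 0 < δ) :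
    ∃ L : ℝ, 0 < L ∧ ∀ a ∈ Set.Icc (-M) M, ∃ w : ℝ → ℝ, ContDiff ℝ 1 w ∧ w 0 = a ∧
      (∀ x, L ≤ x → w x = -1) ∧ ∀ b, L ≤ b → energy V 0 b w ≤ |aPhi V a| + δ := by
  obtain ⟨B, hB⟩ : ∃ B, ∀ x ∈ Set.Icc (-M) M, V x ≤ B := by
    obtain ⟨B, hB⟩ := (isCompact_Icc (a := -M) (b := M)).bddAbove_image hV.continuousOn
    exact ⟨B, fun x hx => hB ⟨x, hx, rfl⟩⟩
  have hB0 : 0 ≤ B := (h0 0).trans (hB 0 ⟨by linarith, by linarith⟩)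
  set ε := δ / (2 * (M + 1)) with hεd
  have hε : 0 < ε := by positivity
  set τ := δ / (2 * (B + 1)) with hτd
  have hτ : 0 < τ := by positivity
  let g : ℝ → ℝ := fun r => Real.sqrt (2 * V (max (-M) (min r M)) + ε^2)
  have hg : Continuous g := by fun_prop
  have hclip : ∀ r : ℝ, max (-M) (min r M) ∈ Set.Icc (-M) M := fun r =>
    ⟨le_max_left _ _, max_le (by linarith) (min_le_right _ _)⟩
  have hg1 : ∀ r, ε ≤ g r := fun r => by
    apply Real.le_sqrt_of_sq_le
    have := h0 (max (-M) (min r M))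
    linarith
  have hg2 : ∀ r, g r ≤ Real.sqrt (2 * B + ε^2) := fun r => by
    apply Real.sqrt_le_sqrt
    have := hB _ (hclip r)
    linarith
  have hgin : ∀ r ∈ Set.Icc (-M) M, g r = Real.sqrt (2 * V r + ε^2) := fun r hr => by
    simp only [g]; rw [min_eq_left hr.2, max_eq_right hr.1]
  obtain ⟨S, hS, hS0, hSm, hSs⟩ := aux_flow g hg ε _ hε hg1 hg2
  obtain ⟨ψ, p, hψ, hp, hp0, hp1, hpt, hpn, hψn, hψm, hψs⟩ := aux_psi τ hτ
  refine ⟨(M + 1) / ε + τ, by positivity, ?_⟩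
  intro a ha
  obtain ⟨s, hsa, hs⟩ := hSs a
  have hs' : |s| ≤ (M + 1) / ε := hs.trans (by
    gcongr; rw [abs_le]; constructor <;> linarith [ha.1, ha.2])
  obtain ⟨σ, hσ, hσs⟩ : ∃ σ : ℝ, (σ = 1 ∨ σ = -1) ∧ σ * |s| = s := by
    rcases le_total 0 s with h | h
    · exact ⟨1, Or.inl rfl, by rw [abs_of_nonneg h]; ring⟩
    · exact ⟨-1, Or.inr rfl, by rw [abs_of_nonpos h]; ring⟩
  have hσ2 : σ * σ = 1 := by rcases hσ with h | h <;> rw [h] <;> norm_num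
  obtain ⟨t, ht0, ht1, hts⟩ := hψs |s| (abs_nonneg s)
  have htL : t ≤ (M + 1) / ε + τ := by linarith
  let w : ℝ → ℝ := fun x => S (σ * ψ (t - x))
  have hw : ∀ x, HasDerivAt w (g (w x) * (σ * -p (t - x))) x := fun x => by
    have h1 : HasDerivAt (fun y => ψ (t - y)) (-p (t - x)) x := by
      have := (hψ (t - x)).comp x ((hasDerivAt_id x).const_sub t)
      rw [mul_neg_one] at this
      exact this
    exact (hS _).comp x (h1.const_mul σ)
  have hwc : Continuous w := continuous_iff_continuousAt.2 fun x => (hw x).continuousAt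
  have hdw : deriv w = fun x => g (w x) * (σ * -p (t - x)) := funext fun x => (hw x).deriv
  have hwC : ContDiff ℝ 1 w := by
    rw [contDiff_one_iff_deriv]
    refine ⟨fun x => (hw x).differentiableAt, ?_⟩
    rw [hdw]; fun_prop
  have hw0 : w 0 = a := by simp only [w, sub_zero, hts, hσs, hsa]
  have hwt : ∀ x, t ≤ x → w x = -1 := fun x hx => by
    simp only [w]; rw [hψn _ (by linarith)]; simp [hS0]
  have hwr : ∀ x, 0 ≤ x → w x ∈ Set.Icc (-M) M := fun x hx => by
    have h1 : ψ (t - x) ≤ |s| := by rw [← hts]; exact hψm (by linarith)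
    have h2 : 0 ≤ ψ (t - x) := by
      rcases le_total (t - x) 0 with h | h
      · rw [hψn _ h]
      · rw [← hψn 0 le_rfl]; exact hψm h
    rcases hσ with h | h
    · have e1 : w x ≤ a := by rw [← hsa]; apply hSm.monotone; rw [← hσs, h]; linarith
      have e2 : -1 ≤ w x := by rw [← hS0]; apply hSm.monotone; rw [h]; linarith
      exact ⟨by linarith, by linarith [ha.2]⟩
    · have e1 : a ≤ w x := by rw [← hsa]; apply hSm.monotone; rw [← hσs, h]; linarith
      have e2 : w x ≤ -1 := by rw [← hS0]; apply hSm.monotone; rw [h]; linarith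
      exact ⟨by linarith [ha.1], by linarith⟩
  refine ⟨w, hwC, hw0, fun x hx => hwt x (by linarith), ?_⟩
  intro b hb
  have hb0 : 0 ≤ b := by linarith
  -- the primitive of g
  let Γ : ℝ → ℝ := fun r => ∫ y in (-1:ℝ)..r, g y
  have hΓ : ∀ r, HasDerivAt Γ (g r) r := fun r => (hg.integral_hasStrictDerivAt (-1) r).hasDerivAt
  have hΓw : ∀ x, HasDerivAt (fun x => -σ * Γ (w x)) (g (w x) ^ 2 * p (t - x)) x := fun x => by
    have := ((hΓ (w x)).comp x (hw x)).const_mul (-σ)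
    have h9 : -σ * (g (w x) * (g (w x) * (σ * -p (t - x)))) = (σ * σ) * (g (w x) ^ 2 * p (t - x)) := by ring
    rw [h9, hσ2, one_mul] at this
    exact this
  have hc1 : Continuous (fun x => g (w x) ^ 2 * p (t - x)) := by fun_prop
  have hI1 : ∫ x in (0:ℝ)..b, g (w x) ^ 2 * p (t - x) = σ * Γ a := by
    rw [intervalIntegral.integral_eq_sub_of_hasDerivAt (fun x _ => hΓw x) (hc1.intervalIntegrable _ _),
      hwt b (by linarith), hw0]
    simp [Γ]
  have hind : IntervalIntegrable ((Set.Icc (t - τ) t).indicator (fun _ => B)) volume 0 b := by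
    rw [intervalIntegrable_iff]
    exact (integrableOn_const (by simp)).indicator measurableSet_Icc
  have hI2 : ∫ x in (0:ℝ)..b, (Set.Icc (t - τ) t).indicator (fun _ => B) x ≤ B * τ := by
    rw [intervalIntegral.integral_of_le hb0, ← integral_indicator measurableSet_Ioc]
    have hle : ∫ x, (Set.Ioc 0 b).indicator ((Set.Icc (t - τ) t).indicator (fun _ => B)) x
        ≤ ∫ x, (Set.Icc (t - τ) t).indicator (fun _ => B) x := by
      apply integral_mono_of_nonneg
      · exact Filter.Eventually.of_forall fun x =>
          Set.indicator_nonneg (fun _ _ => Set.indicator_nonneg (fun _ _ => hB0) _) _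
      · exact (integrable_indicator_iff measurableSet_Icc).2 (integrableOn_const (by simp))
      · exact Filter.Eventually.of_forall fun x =>
          Set.indicator_le_self' (fun _ _ => Set.indicator_nonneg (fun _ _ => hB0) _) _
    refine hle.trans (le_of_eq ?_)
    rw [integral_indicator measurableSet_Icc, setIntegral_const]
    simp [hτ.le, mul_comm]
  have hpt' : ∀ x ∈ Set.Icc 0 b, (1/2) * (deriv w x)^2 + V (w x) ≤
      g (w x) ^ 2 * p (t - x) + (Set.Icc (t - τ) t).indicator (fun _ => B) x := by
    intro x hx
    rw [hdw]
    simp only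
    have hgw : g (w x) ^ 2 = 2 * V (w x) + ε^2 := by
      rw [hgin _ (hwr x hx.1), Real.sq_sqrt]
      have := h0 (w x); positivity
    have hVw := h0 (w x)
    have e1 : (g (w x) * (σ * -p (t - x)))^2 = g (w x)^2 * p (t-x)^2 := by
      linear_combination (g (w x)^2 * p (t-x)^2) * hσ2
    rw [e1]
    have hq0 := hp0 (t - x)
    have hq1 := hp1 (t - x)
    have hsq : p (t-x)^2 ≤ p (t-x) := by nlinarith
    have e2 : g (w x)^2 * p (t-x)^2 ≤ g (w x)^2 * p (t-x) :=
      mul_le_mul_of_nonneg_left hsq (sq_nonneg _)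
    have e3 : V (w x) * p (t-x) ≤ 1/2 * (g (w x)^2) * p (t-x) :=
      mul_le_mul_of_nonneg_right (by rw [hgw]; nlinarith [sq_nonneg ε]) hq0
    have e4 : V (w x) * (1 - p (t-x)) ≤ (Set.Icc (t - τ) t).indicator (fun _ => B) x := by
      by_cases hxt : x ∈ Set.Icc (t - τ) t
      · rw [Set.indicator_of_mem hxt]
        have := hB _ (hwr x hx.1)
        nlinarith
      · rw [Set.indicator_of_notMem hxt]
        rcases lt_or_ge x (t - τ) with h | h
        · rw [hpt _ (by linarith)]; simp
        · have : t < x := by by_contra h'; exact hxt ⟨h, not_lt.1 h'⟩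
          rw [hwt x this.le, hm1]; simp
    linarith
  have hE : energy V 0 b w ≤ σ * Γ a + B * τ := by
    have := intervalIntegral.integral_mono_on hb0
      ((dens_cont V hV w hwC).intervalIntegrable 0 b)
      ((hc1.intervalIntegrable 0 b).add hind) hpt'
    have h3 := intervalIntegral.integral_add (hc1.intervalIntegrable 0 b) hind
    unfold energy
    linarith
  have hG : |Γ a - aPhi V a| ≤ ε * |a + 1| := by
    have hcs : Continuous (fun r => Real.sqrt (2 * V r)) := by fun_prop
    have e : Γ a - aPhi V a = ∫ r in (-1:ℝ)..a, (g r - Real.sqrt (2 * V r)) := by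
      rw [intervalIntegral.integral_sub (hg.intervalIntegrable _ _) (hcs.intervalIntegrable _ _)]
      rfl
    rw [e]
    have := intervalIntegral.norm_integral_le_of_norm_le_const (a := -1) (b := a)
      (f := fun r => g r - Real.sqrt (2 * V r)) (C := ε) (fun x hx => by
        have hx' : x ∈ Set.Icc (-M) M := by
          have hx2 := Set.uIoc_subset_uIcc hx
          have : Set.uIcc (-1) a ⊆ Set.Icc (-M) M :=
            Set.uIcc_subset_Icc ⟨by linarith, by linarith⟩ ha
          exact this hx2
        rw [hgin x hx', Real.norm_eq_abs, abs_le]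
        have hv := h0 x
        have a1 : Real.sqrt (2 * V x) ≤ Real.sqrt (2 * V x + ε^2) :=
          Real.sqrt_le_sqrt (by nlinarith [sq_nonneg ε])
        have a2 : Real.sqrt (2 * V x + ε^2) ≤ Real.sqrt (2 * V x) + ε := by
          apply Real.sqrt_le_iff.2
          refine ⟨by positivity, ?_⟩
          have := Real.sq_sqrt (show 0 ≤ 2 * V x by positivity)
          nlinarith [mul_nonneg (Real.sqrt_nonneg (2 * V x)) hε.le]
        constructor <;> linarith)
    rw [sub_neg_eq_add] at this
    exact this
  have hG2 : σ * Γ a ≤ |aPhi V a| + ε * |a + 1| := by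
    have h1 := abs_le.1 hG
    have h2 := le_abs_self (aPhi V a)
    have h3 := neg_abs_le (aPhi V a)
    rcases hσ with h | h <;> rw [h] <;> linarith [h1.1, h1.2]
  have ha1 : |a + 1| ≤ M + 1 := by rw [abs_le]; constructor <;> linarith [ha.1, ha.2]
  have hε1 : ε * |a + 1| ≤ δ / 2 := by
    calc ε * |a+1| ≤ ε * (M + 1) := by gcongr
      _ = δ / 2 := by rw [hεd]; field_simp
  have hτ1 : B * τ ≤ δ / 2 := by
    calc B * τ ≤ (B + 1) * τ := by gcongr; linarith
      _ = δ / 2 := by rw [hτd]; field_simp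
  linarith

lemma aux_V0 (V : ℝ → ℝ) (hV : Assumption1 V) : 0 < V 0 := by
  rcases (hV.nonneg 0).lt_or_eq with h | h
  · exact h
  · exfalso
    have h1 : V 1 = 0 := (hV.zero_iff 1 one_pos).2 rfl
    obtain ⟨c, hc, hd⟩ := exists_deriv_eq_zero (f := V) zero_lt_one hV.smooth.continuous.continuousOn (by rw [← h, h1])
    have := (hV.deriv_zero_iff c hc.1).1 hd
    linarith [hc.2]

lemma aux_eta (V : ℝ → ℝ) (hV : Assumption1 V) (δ : ℝ) (hδ : 0 < δ) :
    ∃ η : ℝ, 0 < η ∧ ∀ s, s ≤ 1 - δ/2 → V s < η → |s + 1| ≤ δ := by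
  obtain ⟨C, hC, β, hβ, hgr⟩ := hV.growth
  let K : Set ℝ := Set.Icc (-(max C 1)) (1 - δ/2) ∩ {s | δ ≤ |s + 1|}
  have hK : IsCompact K := isCompact_Icc.inter_right
    (isClosed_le continuous_const (by fun_prop))
  have hpos : ∀ s ∈ K, 0 < V s := by
    intro s hs
    refine lt_of_le_of_ne (hV.nonneg s) (fun h => ?_)
    rcases lt_trichotomy s 0 with h1 | h1 | h1
    · have := (hV.zero_iff (-s) (by linarith)).1 (by rw [hV.even]; exact h.symm)
      have h2 : s = -1 := by linarith
      have := hs.2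
      simp [h2] at this
      linarith
    · rw [h1] at h; linarith [aux_V0 V hV]
    · have := (hV.zero_iff s h1).1 h.symm
      have := hs.1.2
      linarith
  obtain ⟨m, hm, hmK⟩ : ∃ m : ℝ, 0 < m ∧ ∀ s ∈ K, m ≤ V s := by
    rcases K.eq_empty_or_nonempty with h | h
    · exact ⟨1, one_pos, by simp [h]⟩
    · obtain ⟨x, hx, hmin⟩ := hK.exists_isMinOn h hV.smooth.continuous.continuousOn
      exact ⟨V x, hpos x hx, fun s hs => hmin hs⟩
  refine ⟨min m (1 / C), lt_min hm (by positivity), ?_⟩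
  intro s hs hVs
  by_contra hcon
  push Not at hcon
  rcases lt_or_ge s (-(max C 1)) with h | h
  · have h1 : C ≤ -s := by linarith [le_max_left C 1]
    have h2 : 1 ≤ -s := by linarith [le_max_right C 1]
    have h3 := hgr (-s) h1
    rw [hV.even] at h3
    have h4 : 1 ≤ (-s) ^ (1 + β) := Real.one_le_rpow h2 (by linarith)
    have h5 : 1 / C ≤ (-s) ^ (1 + β) / C := by gcongr
    linarith [min_le_right m (1/C)]
  · have := hmK s ⟨⟨h, hs⟩, hcon.le⟩
    linarith [min_le_left m (1/C)]

lemma energy_congr (V : ℝ → ℝ) (u v : ℝ → ℝ) (hu : ContDiff ℝ 1 u) (hv : ContDiff ℝ 1 v)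
    (a b : ℝ) (hab : a ≤ b) (h : ∀ x ∈ Set.Ioo a b, u x = v x) :
    energy V a b u = energy V a b v := by
  unfold energy
  rw [intervalIntegral.integral_of_le hab, intervalIntegral.integral_of_le hab,
    integral_Ioc_eq_integral_Ioo, integral_Ioc_eq_integral_Ioo]
  apply setIntegral_congr_fun measurableSet_Ioo
  intro x hx
  have he : u =ᶠ[nhds x] v := by
    filter_upwards [Ioo_mem_nhds hx.1 hx.2] with y hy using h y hy
  simp only
  rw [he.deriv_eq, h x hx]

lemma energy_shift (V : ℝ → ℝ) (w : ℝ → ℝ) (a b c : ℝ) :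
    energy V a b (fun x => w (x + c)) = energy V (a + c) (b + c) w := by
  unfold energy
  rw [← intervalIntegral.integral_comp_add_right]
  simp only [deriv_comp_add_const]

lemma energy_refl (V : ℝ → ℝ) (w : ℝ → ℝ) (a b c : ℝ) :
    energy V a b (fun x => w (c - x)) = energy V (c - b) (c - a) w := by
  unfold energy
  rw [← intervalIntegral.integral_comp_sub_left]
  simp only [deriv_comp_const_sub, neg_sq]

lemma aPhi_lip (V : ℝ → ℝ) (hV : Continuous V) (G : ℝ)
    (hG : ∀ x ∈ Set.Icc (-2:ℝ) 0, Real.sqrt (2 * V x) ≤ G) (x y : ℝ)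
    (hx : x ∈ Set.Icc (-2:ℝ) 0) (hy : y ∈ Set.Icc (-2:ℝ) 0) :
    |aPhi V y - aPhi V x| ≤ G * |y - x| := by
  have hc : Continuous (fun r => Real.sqrt (2 * V r)) := by fun_prop
  have e : aPhi V y - aPhi V x = ∫ r in x..y, Real.sqrt (2 * V r) := by
    unfold aPhi
    rw [intervalIntegral.integral_interval_sub_left] <;> exact hc.intervalIntegrable _ _
  rw [e]
  exact intervalIntegral.norm_integral_le_of_norm_le_const (C := G) (fun r hr => by
    rw [Real.norm_eq_abs, abs_of_nonneg (Real.sqrt_nonneg _)]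
    exact hG r (Set.uIcc_subset_Icc hx hy (Set.uIoc_subset_uIcc hr)))

lemma aPhi_mono (V : ℝ → ℝ) (hV : Continuous V) : Monotone (aPhi V) :=
  monotone_of_deriv_nonneg (fun x => (aPhi_deriv V hV x).differentiableAt)
    (fun x => by rw [(aPhi_deriv V hV x).deriv]; exact Real.sqrt_nonneg _)

lemma aPhi_m1 (V : ℝ → ℝ) : aPhi V (-1) = 0 := by simp [aPhi]

lemma c1_eq (V : ℝ → ℝ) : c1 V = 2 * min (aPhi V (-1/2)) (-aPhi V (-3/2)) := by
  unfold c1 aPhi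
  rw [intervalIntegral.integral_symm (-1) (-3/2)]

/-- upper bound for the class `A` -/
lemma upper_A (V : ℝ → ℝ) (hV : Continuous V) (h0 : ∀ x, 0 ≤ V x) (hm1 : V (-1) = 0)
    (M δ : ℝ) (hM : 3 ≤ M) (hδ : 0 < δ) (hδ1 : δ ≤ 1/2) :
    ∃ L : ℝ, 0 < L ∧ ∀ ℓ : ℝ, L ≤ ℓ → ∀ um up : ℝ, um ∈ Set.Icc (-M) M → up ∈ Set.Icc (-M) M →
      sInf {e : ℝ | ∃ u : ℝ → ℝ, ContDiff ℝ 1 u ∧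
                  u (-(2*ℓ)) = um ∧ u (2*ℓ) = up ∧
                  |u (-ℓ)| ≤ M - δ ∧ |u 0| ≤ M - δ ∧ |u ℓ| ≤ M - δ ∧
                  (∀ x ∈ Set.Icc (-ℓ) ℓ, u x ≤ 1 - 2*δ) ∧
                  e = energy V (-(2*ℓ)) (2*ℓ) u} ≤ |aPhi V um| + |aPhi V up| + 2 * δ := by
  obtain ⟨L, hL, hLw⟩ := aux_transition V hV h0 hm1 M δ (by linarith) hδ
  refine ⟨L, hL, ?_⟩
  intro ℓ hℓ um up hum hup
  obtain ⟨w, hw, hw0, hwL, hwE⟩ := hLw um hum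
  obtain ⟨v, hv, hv0, hvL, hvE⟩ := hLw up hup
  have hcw : ContDiff ℝ 1 (fun x => w (x + 2*ℓ)) := hw.comp (contDiff_id.add contDiff_const)
  have hcv : ContDiff ℝ 1 (fun x => v (2*ℓ - x)) := hv.comp (contDiff_const.sub contDiff_id)
  let u : ℝ → ℝ := fun x => w (x + 2*ℓ) + v (2*ℓ - x) + 1
  have hu : ContDiff ℝ 1 u := (hcw.add hcv).add contDiff_const
  have hmid : ∀ x, -ℓ ≤ x → x ≤ ℓ → u x = -1 := fun x h1 h2 => by
    simp only [u]; rw [hwL _ (by linarith), hvL _ (by linarith)]; norm_num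
  have hE : energy V (-(2*ℓ)) (2*ℓ) u ≤ |aPhi V um| + |aPhi V up| + 2 * δ := by
    rw [energy_add V hV u hu _ 0 _]
    rw [energy_congr V u _ hu hcw (-(2*ℓ)) 0 (by linarith) (fun x hx => by
      simp only [u]; rw [hvL _ (by linarith [hx.2])]; ring)]
    rw [energy_congr V u _ hu hcv 0 (2*ℓ) (by linarith) (fun x hx => by
      simp only [u]; rw [hwL _ (by linarith [hx.1])]; ring)]
    rw [energy_shift, energy_refl]
    have e1 := hwE (2*ℓ) (by linarith)
    have e2 := hvE (2*ℓ) (by linarith)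
    simp only [neg_add_cancel, zero_add, sub_self, sub_zero]
    linarith
  refine le_trans (csInf_le ⟨0, ?_⟩ ?_) hE
  · rintro e ⟨u, -, -, -, -, -, -, -, rfl⟩
    exact energy_nonneg V h0 u _ _ (by linarith)
  refine ⟨u, hu, ?_, ?_, ?_, ?_, ?_, ?_, rfl⟩
  · simp only [u, neg_add_cancel, hw0]; rw [hvL _ (by linarith)]; ring
  · simp only [u, sub_self, hv0]; rw [hwL _ (by linarith)]; ring
  · rw [hmid _ le_rfl (by linarith)]; norm_num; linarith
  · rw [hmid _ (by linarith) (by linarith)]; norm_num; linarith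
  · rw [hmid _ (by linarith) le_rfl]; norm_num; linarith
  · intro x hx; rw [hmid _ hx.1 hx.2]; linarith

lemma nonempty_At (V : ℝ → ℝ) (M δ : ℝ) (hM : 3 ≤ M) (hδ : 0 < δ) (hδ1 : δ ≤ 1/2) (ℓ : ℝ)
    (hℓ : 0 < ℓ) (um up : ℝ) (hum : um ∈ Set.Icc (-M) M) (hup : up ∈ Set.Icc (-M) M) :
    {e : ℝ | ∃ u : ℝ → ℝ, ContDiff ℝ 1 u ∧
                  u (-(2*ℓ)) = um ∧ u (2*ℓ) = up ∧
                  |u (-ℓ)| ≤ M + δ ∧ |u 0| ≤ M + δ ∧ |u ℓ| ≤ M + δ ∧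
                  (∀ x ∈ Set.Icc (-ℓ) ℓ, u x ≤ 1 - δ/2) ∧
                  (1 - δ)/2 ≤ |u 0 + 1| ∧
                  e = energy V (-(2*ℓ)) (2*ℓ) u}.Nonempty := by
  obtain ⟨h1, h2⟩ := hum
  obtain ⟨h3, h4⟩ := hup
  let q : ℝ → ℝ := fun s => -(2*M/3) * (1 - s^2) + um * (s * (s-1)/2) + up * (s*(s+1)/2)
  let u : ℝ → ℝ := fun x => q (x / (2*ℓ))
  have hu : ContDiff ℝ 1 u := by
    simp only [u, q]; fun_prop
  have e1 : -(2*ℓ) / (2*ℓ) = -1 := by field_simp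
  have e2 : (2*ℓ) / (2*ℓ) = 1 := by field_simp
  have e3 : -ℓ / (2*ℓ) = -1/2 := by field_simp
  have e4 : ℓ / (2*ℓ) = 1/2 := by field_simp
  refine ⟨_, u, hu, ?_, ?_, ?_, ?_, ?_, ?_, ?_, rfl⟩
  · simp only [u, q, e1]; ring
  · simp only [u, q, e2]; ring
  · simp only [u, q, e3]; rw [abs_le]; constructor <;> linarith
  · simp only [u, q, zero_div]; rw [abs_le]; constructor <;> linarith
  · simp only [u, q, e4]; rw [abs_le]; constructor <;> linarith
  · intro x hx
    have g1 : -(1/2) ≤ x / (2*ℓ) := by rw [le_div_iff₀ (by positivity)]; linarith [hx.1]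
    have g2 : x / (2*ℓ) ≤ 1/2 := by rw [div_le_iff₀ (by positivity)]; linarith [hx.2]
    simp only [u, q]
    generalize x / (2*ℓ) = s at g1 g2
    have : -(2*M/3) * (1 - s^2) + um * (s * (s-1)/2) + up * (s*(s+1)/2) ≤ 0 := by
      rcases le_total 0 s with hs | hs
      · have a1 : um * (s * (s-1)/2) ≤ M * (s * (1 - s)/2) := by
          nlinarith [mul_nonneg hs (show 0 ≤ 1 - s by linarith)]
        have a2 : up * (s*(s+1)/2) ≤ M * (s*(s+1)/2) :=
          mul_le_mul_of_nonneg_right h4 (by positivity)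
        have a3 : M * (s - (2/3) * (1 - s^2)) ≤ 0 :=
          mul_nonpos_of_nonneg_of_nonpos (by linarith) (by nlinarith)
        nlinarith
      · have a1 : up * (s * (s+1)/2) ≤ M * (-s * (1 + s)/2) := by
          nlinarith [mul_nonneg (neg_nonneg.2 hs) (show 0 ≤ 1 + s by linarith)]
        have a2 : um * (s*(s-1)/2) ≤ M * (s*(s-1)/2) :=
          mul_le_mul_of_nonneg_right h2 (by nlinarith)
        have a3 : M * (-s - (2/3) * (1 - s^2)) ≤ 0 :=
          mul_nonpos_of_nonneg_of_nonpos (by linarith) (by nlinarith)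
        nlinarith
    linarith
  · simp only [u, q, zero_div]
    rw [abs_of_nonpos] <;> linarith

/-- Cost of a half-excursion away from `−1` (Lemma 6.2). -/
theorem half_excursion_cost
    (V : ℝ → ℝ) (hV : Assumption1 V) :
    ∃ C : ℝ, 0 < C ∧ ∃ M₀ : ℝ, ∀ M : ℝ, M₀ ≤ M →
      ∃ δ₀ : ℝ, 0 < δ₀ ∧ ∀ δ : ℝ, 0 < δ → δ ≤ δ₀ →
        ∃ lstar : ℝ, ∀ ℓ : ℝ, lstar ≤ ℓ →
          ∀ um up : ℝ, um ∈ Set.Icc (-M) M → up ∈ Set.Icc (-M) M →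
            c1 V - C * δ ≤
              sInf {e : ℝ | ∃ u : ℝ → ℝ, ContDiff ℝ 1 u ∧
                  u (-(2*ℓ)) = um ∧ u (2*ℓ) = up ∧
                  |u (-ℓ)| ≤ M + δ ∧ |u 0| ≤ M + δ ∧ |u ℓ| ≤ M + δ ∧
                  (∀ x ∈ Set.Icc (-ℓ) ℓ, u x ≤ 1 - δ/2) ∧
                  (1 - δ)/2 ≤ |u 0 + 1| ∧
                  e = energy V (-(2*ℓ)) (2*ℓ) u} -
              sInf {e : ℝ | ∃ u : ℝ → ℝ, ContDiff ℝ 1 u ∧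
                  u (-(2*ℓ)) = um ∧ u (2*ℓ) = up ∧
                  |u (-ℓ)| ≤ M - δ ∧ |u 0| ≤ M - δ ∧ |u ℓ| ≤ M - δ ∧
                  (∀ x ∈ Set.Icc (-ℓ) ℓ, u x ≤ 1 - 2*δ) ∧
                  e = energy V (-(2*ℓ)) (2*ℓ) u} := by

  have hVc : Continuous V := hV.smooth.continuous
  have h0 := hV.nonneg
  have hm1 : V (-1) = 0 := by rw [hV.even]; exact (hV.zero_iff 1 one_pos).2 rfl
  obtain ⟨G, hG0, hG⟩ : ∃ G : ℝ, 0 ≤ G ∧ ∀ x ∈ Set.Icc (-2:ℝ) 0, Real.sqrt (2 * V x) ≤ G := by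
    have hc : Continuous (fun r => Real.sqrt (2 * V r)) := by fun_prop
    obtain ⟨B, hB⟩ := (isCompact_Icc (a := (-2:ℝ)) (b := 0)).bddAbove_image hc.continuousOn
    exact ⟨B, (Real.sqrt_nonneg _).trans (hB ⟨0, by norm_num, rfl⟩), fun x hx => hB ⟨x, hx, rfl⟩⟩
  have hlip := aPhi_lip V hVc G hG
  have hmono := aPhi_mono V hVc
  have hphi0 := aPhi_m1 V
  refine ⟨5 * G + 2, by positivity, 3, ?_⟩
  intro M hM
  refine ⟨1/2, by norm_num, ?_⟩
  intro δ hδ hδ1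
  obtain ⟨L, hL, hA⟩ := upper_A V hVc h0 hm1 M δ hM hδ hδ1
  obtain ⟨η, hη, hηs⟩ := aux_eta V hV δ hδ
  have hphic : Continuous (aPhi V) :=
    continuous_iff_continuousAt.2 fun x => (aPhi_deriv V hVc x).continuousAt
  obtain ⟨K, hK⟩ : ∃ K : ℝ, ∀ x ∈ Set.Icc (-M) M, |aPhi V x| ≤ K := by
    obtain ⟨B, hB⟩ := (isCompact_Icc (a := -M) (b := M)).bddAbove_image hphic.abs.continuousOn
    exact ⟨B, fun x hx => hB ⟨x, hx, rfl⟩⟩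
  refine ⟨max L ((2 * K + c1 V) / η), ?_⟩
  intro ℓ hℓ um up hum hup
  have hℓL : L ≤ ℓ := (le_max_left _ _).trans hℓ
  have hℓ0 : 0 < ℓ := by linarith
  have hℓη : 2 * K + c1 V ≤ η * ℓ := by
    have := (le_max_right _ _).trans hℓ
    rw [div_le_iff₀ hη] at this
    linarith
  have hupper := hA ℓ hℓL um up hum hup
  have hKm := hK um hum
  have hKp := hK up hup
  have hGδ : 0 ≤ G * δ := by positivity
  have hlower : |aPhi V um| + |aPhi V up| + c1 V - 5 * G * δ ≤ sInf {e : ℝ | ∃ u : ℝ → ℝ, ContDiff ℝ 1 u ∧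
                  u (-(2*ℓ)) = um ∧ u (2*ℓ) = up ∧
                  |u (-ℓ)| ≤ M + δ ∧ |u 0| ≤ M + δ ∧ |u ℓ| ≤ M + δ ∧
                  (∀ x ∈ Set.Icc (-ℓ) ℓ, u x ≤ 1 - δ/2) ∧
                  (1 - δ)/2 ≤ |u 0 + 1| ∧
                  e = energy V (-(2*ℓ)) (2*ℓ) u} := by
    apply le_csInf (nonempty_At V M δ hM hδ hδ1 ℓ hℓ0 um up hum hup)
    rintro e ⟨u, hu, hu1, hu2, -, -, -, hu3, hu4, rfl⟩
    have hnn := fun a b => energy_nonneg V h0 u a b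
    by_cases hc1 : ∀ x ∈ Set.Icc (-ℓ) 0, η ≤ V (u x)
    · have := energy_ge_const V hVc u hu (-ℓ) 0 η (by linarith) hc1
      rw [energy_add V hVc u hu _ (-ℓ) _, energy_add V hVc u hu (-ℓ) 0 _]
      linarith [hnn (-(2*ℓ)) (-ℓ) (by linarith), hnn 0 (2*ℓ) (by linarith)]
    by_cases hc2 : ∀ x ∈ Set.Icc 0 ℓ, η ≤ V (u x)
    · have := energy_ge_const V hVc u hu 0 ℓ η (by linarith) hc2
      rw [energy_add V hVc u hu _ 0 _, energy_add V hVc u hu 0 ℓ _]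
      linarith [hnn (-(2*ℓ)) 0 (by linarith), hnn ℓ (2*ℓ) (by linarith)]
    push Not at hc1 hc2
    obtain ⟨x, hx, hxη⟩ := hc1
    obtain ⟨y, hy, hyη⟩ := hc2
    have hxd := hηs (u x) (hu3 x ⟨hx.1, by linarith [hx.2]⟩) hxη
    have hyd := hηs (u y) (hu3 y ⟨by linarith [hy.1], hy.2⟩) hyη
    have near : ∀ s, |s + 1| ≤ δ → |aPhi V s| ≤ G * δ := by
      intro s hs
      have h := abs_le.1 hs
      have h2 := hlip (-1) s ⟨by norm_num, by norm_num⟩ ⟨by linarith [h.1], by linarith [h.2]⟩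
      rw [hphi0, sub_zero, sub_neg_eq_add] at h2
      exact h2.trans (by gcongr)
    have nx := near _ hxd
    have ny := near _ hyd
    have hu0 : c1 V / 2 - G * δ / 2 ≤ |aPhi V (u 0)| := by
      rw [c1_eq]
      rcases le_abs.1 hu4 with h | h
      · have h1 : aPhi V (-1/2 - δ/2) ≤ aPhi V (u 0) := hmono (by linarith)
        have h2 := hlip (-1/2) (-1/2 - δ/2) ⟨by norm_num, by norm_num⟩ ⟨by linarith, by linarith⟩
        rw [show -1/2 - δ/2 - -1/2 = -(δ/2) by ring, abs_neg, abs_of_pos (half_pos hδ)] at h2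
        have h3 := (abs_le.1 h2).1
        have h4 := min_le_left (aPhi V (-1/2)) (-aPhi V (-3/2))
        linarith [le_abs_self (aPhi V (u 0))]
      · have h1 : aPhi V (u 0) ≤ aPhi V (-3/2 + δ/2) := hmono (by linarith)
        have h2 := hlip (-3/2) (-3/2 + δ/2) ⟨by norm_num, by norm_num⟩ ⟨by linarith, by linarith⟩
        rw [show -3/2 + δ/2 - -3/2 = (δ/2) by ring, abs_of_pos (half_pos hδ)] at h2
        have h3 := (abs_le.1 h2).2
        have h4 := min_le_right (aPhi V (-1/2)) (-aPhi V (-3/2))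
        linarith [neg_abs_le (aPhi V (u 0))]
    have g1 := energy_ge V hVc h0 u hu (-(2*ℓ)) x (by linarith [hx.1])
    have g2 := energy_ge V hVc h0 u hu x 0 hx.2
    have g3 := energy_ge V hVc h0 u hu 0 y hy.1
    have g4 := energy_ge V hVc h0 u hu y (2*ℓ) (by linarith [hy.2])
    rw [hu1] at g1
    rw [hu2] at g4
    rw [energy_add V hVc u hu _ x _, energy_add V hVc u hu x 0 _, energy_add V hVc u hu 0 y _]
    have k1 := abs_sub_abs_le_abs_sub (aPhi V um) (aPhi V (u x))
    rw [abs_sub_comm] at k1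
    have k2 := abs_sub_abs_le_abs_sub (aPhi V (u 0)) (aPhi V (u x))
    have k3 := abs_sub_abs_le_abs_sub (aPhi V (u 0)) (aPhi V (u y))
    rw [abs_sub_comm] at k3
    have k4 := abs_sub_abs_le_abs_sub (aPhi V up) (aPhi V (u y))
    linarith
  linarith
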